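/- arXiv:2001.06359 — 2 statements merged into one kernel-verified Lean document; each statement's English description precedes it below -/
import Mathlib

section
/- Let k be a field and let U be the group of 3 × 3 upper unitriangular matrices over k (upper triangular with all diagonal entries 1). For t ∈ kˣ let h(t) = [[1, t, 0], [0, 1, 1], [0, 0, 1]] ∈ U. Then for distinct s, t ∈ kˣ, the centralizers of h(s) and h(t) in U are not conjugate in U, i.e. h(s) and h(t) are not z-equivalent in U. Consequently, if k is infinite, then U has infinitely many z-classes. -/
/-- Two elements of a group are *z-equivalent* if their centralizers are conjugate:
there is `a` with `a ⬝ Z(g) ⬝ a⁻¹ = Z(h)`. -/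
def IsZEquiv {G : Type*} [Group G] (g h : G) : Prop :=
  ∃ a : G, ∀ x : G, x ∈ Subgroup.centralizer {g} ↔ a * x * a⁻¹ ∈ Subgroup.centralizer {h}

/-- The group of `3 × 3` upper unitriangular matrices over `k` (upper triangular with all
diagonal entries `1`), as a subgroup of `GL 3 k`. -/
def Unitriangular (k : Type*) [Field k] : Subgroup (GL (Fin 3) k) where
  carrier := {A | A.val 0 0 = 1 ∧ A.val 1 1 = 1 ∧ A.val 2 2 = 1 ∧
    A.val 1 0 = 0 ∧ A.val 2 0 = 0 ∧ A.val 2 1 = 0}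
  one_mem' := by
    refine ⟨?_, ?_, ?_, ?_, ?_, ?_⟩ <;> simp [Matrix.one_apply]
  mul_mem' := by
    rintro a b ⟨ha1, ha2, ha3, ha4, ha5, ha6⟩ ⟨hb1, hb2, hb3, hb4, hb5, hb6⟩
    refine ⟨?_, ?_, ?_, ?_, ?_, ?_⟩ <;>
      simp [Units.val_mul, Matrix.mul_apply, Fin.sum_univ_three,
        ha1, ha2, ha3, ha4, ha5, ha6, hb1, hb2, hb3, hb4, hb5, hb6]
  inv_mem' := by
    rintro a ⟨h1, h2, h3, h4, h5, h6⟩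
    have key : (a⁻¹).val * a.val = 1 := a.inv_mul
    have e : ∀ i j, ((a⁻¹).val * a.val) i j = (1 : Matrix (Fin 3) (Fin 3) k) i j := by
      intro i j; rw [key]
    have e10 := e 1 0
    have e20 := e 2 0
    have e21 := e 2 1
    have e00 := e 0 0
    have e11 := e 1 1
    have e22 := e 2 2
    simp only [Matrix.mul_apply, Fin.sum_univ_three, h1, h2, h3, h4, h5, h6,
      Matrix.one_apply, mul_one, mul_zero, add_zero, zero_add,
      if_true, reduceIte] at e10 e20 e21 e00 e11 e22
    have b21 : (a⁻¹).val 2 1 = 0 := by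
      rw [e20] at e21; simpa using e21
    have b11 : (a⁻¹).val 1 1 = 1 := by
      rw [e10] at e11; simpa using e11
    have b22 : (a⁻¹).val 2 2 = 1 := by
      rw [e20, b21] at e22; simpa using e22
    exact ⟨e00, b11, b22, e10, e20, b21⟩

/-- The element `h(t) = [[1, t, 0], [0, 1, 1], [0, 0, 1]]` of the unitriangular group. -/
def hT {k : Type*} [Field k] (t : k) : Unitriangular k :=
  ⟨⟨!![1, t, 0; 0, 1, 1; 0, 0, 1], !![1, -t, t; 0, 1, -1; 0, 0, 1],
      by ext i j; fin_cases i <;> fin_cases j <;>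
        simp [Matrix.mul_apply, Fin.sum_univ_three, Matrix.vecHead, Matrix.vecTail],
      by ext i j; fin_cases i <;> fin_cases j <;>
        simp [Matrix.mul_apply, Fin.sum_univ_three, Matrix.vecHead, Matrix.vecTail]⟩,
    by refine ⟨?_, ?_, ?_, ?_, ?_, ?_⟩ <;> simp [Matrix.vecHead, Matrix.vecTail]⟩

namespace Unitriangular

variable {k : Type*} [Field k]

theorem mul_val_zero_one (x y : Unitriangular k) :
    (x * y).val.val 0 1 = x.val.val 0 1 + y.val.val 0 1 := by
  obtain ⟨hx, -, -, -, -, -⟩ := x.2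
  obtain ⟨-, hy, -, -, -, hy'⟩ := y.2
  simp [Matrix.mul_apply, Fin.sum_univ_three, hx, hy, hy', add_comm]

theorem mul_val_one_two (x y : Unitriangular k) :
    (x * y).val.val 1 2 = x.val.val 1 2 + y.val.val 1 2 := by
  obtain ⟨-, hx, -, hx', -, -⟩ := x.2
  obtain ⟨-, -, hy, -, -, -⟩ := y.2
  simp [Matrix.mul_apply, Fin.sum_univ_three, hx, hx', hy, add_comm]

theorem mul_val_zero_two (x y : Unitriangular k) :
    (x * y).val.val 0 2 = x.val.val 0 2 + y.val.val 0 2 + x.val.val 0 1 * y.val.val 1 2 := by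
  obtain ⟨hx, -, -, -, -, -⟩ := x.2
  obtain ⟨-, -, hy, -, -, -⟩ := y.2
  simp [Matrix.mul_apply, Fin.sum_univ_three, hx, hy]
  ring

theorem conj_val_zero_one (a x : Unitriangular k) :
    (a * x * a⁻¹).val.val 0 1 = x.val.val 0 1 := by
  have h := mul_val_zero_one (a * x * a⁻¹) a
  rw [inv_mul_cancel_right, mul_val_zero_one, add_comm] at h
  exact (add_right_cancel h).symm

theorem conj_val_one_two (a x : Unitriangular k) :
    (a * x * a⁻¹).val.val 1 2 = x.val.val 1 2 := by
  have h := mul_val_one_two (a * x * a⁻¹) a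
  rw [inv_mul_cancel_right, mul_val_one_two, add_comm] at h
  exact (add_right_cancel h).symm

theorem val_mul_val_eq_of_commute {x y : Unitriangular k} (h : x * y = y * x) :
    x.val.val 0 1 * y.val.val 1 2 = y.val.val 0 1 * x.val.val 1 2 := by
  have h' := mul_val_zero_two x y
  rw [h, mul_val_zero_two] at h'
  linear_combination -h'

end Unitriangular

theorem IsZEquiv.refl {G : Type*} [Group G] (g : G) : IsZEquiv g g :=
  ⟨1, fun x => by simp⟩

theorem IsZEquiv.eq_of_hT {k : Type*} [Field k] {s t : k} (h : IsZEquiv (hT s) (hT t)) :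
    s = t := by
  obtain ⟨a, ha⟩ := h
  have hc := (ha (hT s)).1 (Subgroup.mem_centralizer_singleton_iff.2 rfl)
  have hm := Unitriangular.val_mul_val_eq_of_commute
    (Subgroup.mem_centralizer_singleton_iff.1 hc)
  rw [Unitriangular.conj_val_zero_one, Unitriangular.conj_val_one_two] at hm
  simpa [hT] using hm

/-- For distinct `s, t ∈ kˣ`, the elements `h(s)` and `h(t)` of the group `U` of `3 × 3`
upper unitriangular matrices are not z-equivalent in `U` (their centralizers in `U` are
not conjugate in `U`); consequently, if `k` is infinite then `U` has infinitely many
z-classes. -/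
theorem unitriangular_infinitely_many_zClasses (k : Type*) [Field k] :
    (∀ s t : kˣ, (s : k) ≠ (t : k) → ¬ IsZEquiv (hT (s : k)) (hT (t : k))) ∧
    (Infinite k →
      {C : Set (Unitriangular k) |
        ∃ g : Unitriangular k, C = {h : Unitriangular k | IsZEquiv g h}}.Infinite) := by
  refine ⟨fun s t hst h => hst h.eq_of_hT, fun _ => ?_⟩
  refine Set.infinite_of_injective_forall_mem
    (f := fun t : k => {h : Unitriangular k | IsZEquiv (hT t) h}) (fun s t hst => ?_)
    fun t => ⟨hT t, rfl⟩
  have ht : hT t ∈ {h : Unitriangular k | IsZEquiv (hT s) h} := by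
    rw [show {h : Unitriangular k | IsZEquiv (hT s) h} = _ from hst]
    exact IsZEquiv.refl _
  exact IsZEquiv.eq_of_hT ht
end

section
/- Let B(F) denote the group of invertible upper triangular 2 × 2 matrices over a field F, and let u = [[1, 1], [0, 1]]. Then: (i) B(𝔽₂) is abelian (so in B(𝔽₂) the element u is z-equivalent to the identity); and (ii) for every field F with more than two elements (in particular for the algebraic closure of 𝔽₂), u is not z-equivalent to the identity in B(F), i.e. the centralizer of u in B(F) is not conjugate in B(F) to B(F) itself. -/
/-- The Borel subgroup `B(F)` of invertible upper triangular `2 × 2` matrices over a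
field `F`, as a subgroup of `GL 2 F`. -/
def BorelGL (F : Type*) [Field F] : Subgroup (GL (Fin 2) F) where
  carrier := {A | A.val 1 0 = 0}
  one_mem' := by simp [Matrix.one_apply]
  mul_mem' := by
    intro a b ha hb
    have ha' : a.val 1 0 = 0 := ha
    have hb' : b.val 1 0 = 0 := hb
    show ((a * b).val) 1 0 = 0
    simp only [Units.val_mul, Matrix.mul_apply, Fin.sum_univ_two]
    rw [ha', hb']
    ring
  inv_mem' := by
    intro a ha
    have ha' : a.val 1 0 = 0 := ha
    show (a⁻¹).val 1 0 = 0
    have key : a.val * (a⁻¹).val = 1 := a.mul_inv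
    have e10 : (a.val * (a⁻¹).val) 1 0 = (1 : Matrix (Fin 2) (Fin 2) F) 1 0 := by rw [key]
    simp only [Matrix.mul_apply, Fin.sum_univ_two, ha', Matrix.one_apply, zero_mul,
      zero_add, one_ne_zero, if_false] at e10
    have hdet : IsUnit a.val.det := a.isUnit.map Matrix.detMonoidHom
    rw [Matrix.det_fin_two, ha', mul_zero, sub_zero] at hdet
    have h11 : a.val 1 1 ≠ 0 := fun h => by simp [h] at hdet
    exact (mul_eq_zero.mp e10).resolve_left h11

/-- The unipotent element `u = [[1, 1], [0, 1]]` of `B(F)`. -/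
def uB (F : Type*) [Field F] : BorelGL F :=
  ⟨⟨!![1, 1; 0, 1], !![1, -1; 0, 1],
      by ext i j; fin_cases i <;> fin_cases j <;>
        simp [Matrix.mul_apply, Fin.sum_univ_two],
      by ext i j; fin_cases i <;> fin_cases j <;>
        simp [Matrix.mul_apply, Fin.sum_univ_two]⟩,
    by show _ = (0 : F); simp⟩

theorem isZEquiv_one_iff {G : Type*} [Group G] {g : G} :
    IsZEquiv g 1 ↔ ∀ x : G, x * g = g * x := by
  constructor
  · rintro ⟨a, ha⟩ x
    exact (Subgroup.mem_centralizer_singleton_iff.mp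
      ((ha x).mpr (by simp [Subgroup.mem_centralizer_singleton_iff])))
  · intro h
    refine ⟨1, fun x => ?_⟩
    simp [Subgroup.mem_centralizer_singleton_iff, h x]

theorem BorelGL.diag_ne_zero {F : Type*} [Field F] (x : BorelGL F) :
    x.1.val 0 0 ≠ 0 ∧ x.1.val 1 1 ≠ 0 := by
  have hdet : IsUnit x.1.val.det := x.1.isUnit.map Matrix.detMonoidHom
  have h10 : x.1.val 1 0 = 0 := x.2
  rw [Matrix.det_fin_two, h10, mul_zero, sub_zero] at hdet
  exact mul_ne_zero_iff.mp hdet.ne_zero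

theorem BorelGL.mul_comm_zmod_two (x y : BorelGL (ZMod 2)) : x * y = y * x := by
  have eq_one : ∀ z : ZMod 2, z ≠ 0 → z = 1 := by decide
  have hx : x.1.val 1 0 = 0 := x.2
  have hy : y.1.val 1 0 = 0 := y.2
  have hx0 := eq_one _ (BorelGL.diag_ne_zero x).1
  have hx1 := eq_one _ (BorelGL.diag_ne_zero x).2
  have hy0 := eq_one _ (BorelGL.diag_ne_zero y).1
  have hy1 := eq_one _ (BorelGL.diag_ne_zero y).2
  apply Subtype.ext
  apply Units.ext
  change x.1.val * y.1.val = y.1.val * x.1.val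
  ext i j
  fin_cases i <;> fin_cases j <;>
    simp [Matrix.mul_apply, Fin.sum_univ_two, hx, hy, hx0, hx1, hy0, hy1, add_comm]

/-- The diagonal element `[[t, 0], [0, 1]]` of `B(F)`. -/
def BorelGL.diagOne {F : Type*} [Field F] (t : Fˣ) : BorelGL F :=
  ⟨⟨!![(t : F), 0; 0, 1], !![(t⁻¹ : Fˣ), 0; 0, 1],
      by simp [Matrix.one_fin_two], by simp [Matrix.one_fin_two]⟩,
    by show _ = (0 : F); simp⟩

theorem not_isZEquiv_uB_one {F : Type*} [Field F] (hF : ∃ x : F, x ≠ 0 ∧ x ≠ 1) :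
    ¬ IsZEquiv (uB F) 1 := by
  obtain ⟨t, ht0, ht1⟩ := hF
  intro h
  have hcomm := isZEquiv_one_iff.mp h (BorelGL.diagOne (Units.mk0 t ht0))
  have hentry := congrArg (fun z : BorelGL F => z.1.val 0 1) hcomm
  simp [BorelGL.diagOne, uB, Matrix.mul_apply, Fin.sum_univ_two] at hentry
  exact ht1 hentry

/-- (i) `B(𝔽₂)` is abelian, so `u = [[1,1],[0,1]]` is z-equivalent to the identity in
`B(𝔽₂)`; (ii) over every field `F` with more than two elements — in particular over the
algebraic closure of `𝔽₂` — `u` is not z-equivalent to the identity in `B(F)`. -/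
theorem borel_zEquiv_example :
    ((∀ x y : BorelGL (ZMod 2), x * y = y * x) ∧ IsZEquiv (uB (ZMod 2)) 1) ∧
    (∀ (F : Type) [Field F], (∃ x : F, x ≠ 0 ∧ x ≠ 1) → ¬ IsZEquiv (uB F) 1) ∧
    ¬ IsZEquiv (uB (AlgebraicClosure (ZMod 2))) 1 := by
  refine ⟨⟨BorelGL.mul_comm_zmod_two,
    isZEquiv_one_iff.mpr fun x => BorelGL.mul_comm_zmod_two x _⟩,
    fun F _ hF => not_isZEquiv_uB_one hF, not_isZEquiv_uB_one ?_⟩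
  obtain ⟨x, hx⟩ := Set.Infinite.nonempty
    ((Set.toFinite ({0, 1} : Set (AlgebraicClosure (ZMod 2)))).infinite_compl)
  exact ⟨x, by simpa using hx⟩
end
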